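/- Let m > 0 and let V : ℝ → ℝ be a polynomial with V(0) = V'(0) = V''(0) = 0 and V(s) ≥ 0 for all s ∈ ℝ. Let Φ be a global solution of the nonlinear Klein–Gordon equation ∂ₜ²Φ − ΔΦ + m²Φ + V'(Φ) = 0 with Schwartz Cauchy data, and let Φ⁺ be a free solution which is its future free asymptote. Then for each j ∈ {1,2,3} and all t, s ∈ ℝ: ∫_{ℝ³} ∂ₜΦ(t,x) · ∂_{x_j}Φ(t,x) dx = ∫_{ℝ³} ∂ₜΦ⁺(s,x) · ∂_{x_j}Φ⁺(s,x) dx; i.e., the (conserved) linear momentum of Φ equals the free momentum of its asymptote. The same holds for a past free asymptote Φ⁻. -/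

import Mathlib

noncomputable section

open MeasureTheory Filter Polynomial

open scoped Topology ENNReal

abbrev E3 := EuclideanSpace ℝ (Fin 3)

/-- Time derivative `∂ₜΦ(t, x)`. -/
def timeDeriv (Φ : ℝ × E3 → ℝ) (t : ℝ) (x : E3) : ℝ := deriv (fun s => Φ (s, x)) t

/-- The spatial Laplacian `Δf(x) = ∑ⱼ ∂ⱼ²f(x)`. -/
def lapl (f : E3 → ℝ) (x : E3) : ℝ :=
  ∑ i : Fin 3, iteratedDeriv 2 (fun s : ℝ => f (x + s • EuclideanSpace.single i (1 : ℝ))) 0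

/-- A global solution of the nonlinear Klein-Gordon equation
`∂ₜ²Φ − ΔΦ + m²Φ + V'(Φ) = 0`: a smooth real function on `ℝ × ℝ³` satisfying the
equation, such that `Φ(t,·)` and `∂ₜΦ(t,·)` are Schwartz for every `t`. -/
def IsGlobalSol (m : ℝ) (V : Polynomial ℝ) (Φ : ℝ × E3 → ℝ) : Prop :=
  ContDiff ℝ (⊤ : ℕ∞) Φ ∧
  (∀ (t : ℝ) (x : E3),
    iteratedDeriv 2 (fun s => Φ (s, x)) t - lapl (fun y => Φ (t, y)) x
      + m ^ 2 * Φ (t, x) + (Polynomial.derivative V).eval (Φ (t, x)) = 0) ∧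
  (∀ t : ℝ, ∃ g : SchwartzMap E3 ℝ, ∀ x, g x = Φ (t, x)) ∧
  (∀ t : ℝ, ∃ g : SchwartzMap E3 ℝ, ∀ x, g x = timeDeriv Φ t x)

/-- A free solution: a global solution of the linear Klein-Gordon equation (`V' = 0`). -/
def IsFreeSol (m : ℝ) (Φ : ℝ × E3 → ℝ) : Prop := IsGlobalSol m 0 Φ

/-- `Φ` has Cauchy data `(φ, π)` at `t = 0`. -/
def InitData (Φ : ℝ × E3 → ℝ) (φ π : SchwartzMap E3 ℝ) : Prop :=
  (∀ x, Φ (0, x) = φ x) ∧ (∀ x, timeDeriv Φ 0 x = π x)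

/-- `Ψ` is a future asymptote of `Φ`: the `L² ⊕ L²` distance of the Cauchy data at time
`t` tends to `0` as `t → +∞`. -/
def FutureAsym (Φ Ψ : ℝ × E3 → ℝ) : Prop :=
  Tendsto (fun t : ℝ =>
      eLpNorm (fun x => Φ (t, x) - Ψ (t, x)) 2 volume
        + eLpNorm (fun x => timeDeriv Φ t x - timeDeriv Ψ t x) 2 volume)
    atTop (𝓝 (0 : ℝ≥0∞))

/-- `Ψ` is a past asymptote of `Φ`: same as `FutureAsym` but as `t → −∞`. -/
def PastAsym (Φ Ψ : ℝ × E3 → ℝ) : Prop :=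
  Tendsto (fun t : ℝ =>
      eLpNorm (fun x => Φ (t, x) - Ψ (t, x)) 2 volume
        + eLpNorm (fun x => timeDeriv Φ t x - timeDeriv Ψ t x) 2 volume)
    atBot (𝓝 (0 : ℝ≥0∞))

/-- The `j`-th partial derivative in the spatial variable. -/
def pderiv3 (j : Fin 3) (f : E3 → ℝ) (x : E3) : ℝ :=
  fderiv ℝ f x (EuclideanSpace.single j (1 : ℝ))

lemma smoothTransition_deriv_nonneg (s : ℝ) : 0 ≤ deriv Real.smoothTransition s :=
  Real.smoothTransition.monotone.deriv_nonneg

lemma smoothTransition_deriv_eq_zero {s : ℝ} (hs : s ≤ 0) :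
    deriv Real.smoothTransition s = 0 := by
  apply IsLocalMin.deriv_eq_zero
  refine Eventually.of_forall fun x => ?_
  rw [Real.smoothTransition.zero_of_nonpos hs]
  exact Real.smoothTransition.nonneg x

lemma smoothTransition_continuous_deriv : Continuous (deriv Real.smoothTransition) :=
  (Real.smoothTransition.contDiff (n := 1)).continuous_deriv le_rfl

lemma smoothTransition_hasDerivAt (s : ℝ) :
    HasDerivAt Real.smoothTransition (deriv Real.smoothTransition s) s :=
  ((Real.smoothTransition.contDiff (n := 1)).differentiable one_ne_zero s).hasDerivAt

/-- Differentiation under the integral sign for integrands vanishing, locally uniformly in the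
parameter, outside a compact set. -/
lemma hasDerivAt_integral_of_compact {f f' : ℝ → E3 → ℝ}
    (hf : Continuous (Function.uncurry f)) (hf' : Continuous (Function.uncurry f'))
    (hd : ∀ t x, HasDerivAt (fun s => f s x) (f' t x) t) (t₀ : ℝ) {K : Set E3} (hK : IsCompact K)
    (h0 : ∀ x ∉ K, f t₀ x = 0)
    (h0' : ∀ t ∈ Metric.closedBall t₀ 1, ∀ x ∉ K, f' t x = 0) :
    HasDerivAt (fun t => ∫ x, f t x) (∫ x, f' t₀ x) t₀ := by
  obtain ⟨M, hM⟩ := ((isCompact_closedBall t₀ 1).prod hK).exists_bound_of_continuousOn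
    hf'.continuousOn
  have hft : ∀ t, Continuous (f t) := fun t => hf.comp (by fun_prop : Continuous fun x => (t, x))
  have hft' : ∀ t, Continuous (f' t) := fun t => hf'.comp (by fun_prop : Continuous fun x => (t, x))
  refine (hasDerivAt_integral_of_dominated_loc_of_deriv_le (s := Metric.closedBall t₀ 1)
    (bound := K.indicator fun _ => M)
    (Metric.closedBall_mem_nhds t₀ one_pos)
    (Eventually.of_forall fun t => (hft t).aestronglyMeasurable) ?_
    (hft' t₀).aestronglyMeasurable ?_ ?_ ?_).2
  · exact (hft t₀).integrable_of_hasCompactSupport (HasCompactSupport.intro hK h0)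
  · refine ae_of_all _ fun x t ht => ?_
    by_cases hx : x ∈ K
    · simpa [hx] using hM (t, x) ⟨ht, hx⟩
    · simp [hx, h0' t ht x hx]
  · exact (integrable_indicator_iff hK.measurableSet).2
      (integrableOn_const hK.measure_lt_top.ne)
  · exact ae_of_all _ fun x t _ => hd t x

/-- Integration by parts against the divergence of a `C¹` vector field, for a compactly supported
`C¹` weight. -/
lemma integral_mul_divergence {w : E3 → ℝ} {J : Fin 3 → E3 → ℝ} (hw : ContDiff ℝ 1 w)
    (hwc : HasCompactSupport w) (hJ : ∀ k, ContDiff ℝ 1 (J k)) :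
    ∫ x, w x * ∑ k, fderiv ℝ (J k) x (EuclideanSpace.single k (1 : ℝ))
      = -∫ x, ∑ k, fderiv ℝ w x (EuclideanSpace.single k (1 : ℝ)) * J k x := by
  have c1 : ∀ (f : E3 → ℝ) (v : E3), ContDiff ℝ 1 f → Continuous fun x => fderiv ℝ f x v :=
    fun f v hf => (hf.continuous_fderiv one_ne_zero).clm_apply continuous_const
  have i1 : ∀ k, Integrable fun x =>
      w x * fderiv ℝ (J k) x (EuclideanSpace.single k (1 : ℝ)) := fun k =>
    (hw.continuous.mul (c1 _ _ (hJ k))).integrable_of_hasCompactSupport hwc.mul_right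
  have i2 : ∀ k, Integrable fun x =>
      fderiv ℝ w x (EuclideanSpace.single k (1 : ℝ)) * J k x := fun k =>
    ((c1 _ _ hw).mul (hJ k).continuous).integrable_of_hasCompactSupport
      (hwc.fderiv_apply (𝕜 := ℝ) _).mul_right
  have i3 : ∀ k, Integrable fun x => w x * J k x := fun k =>
    (hw.continuous.mul (hJ k).continuous).integrable_of_hasCompactSupport hwc.mul_right
  simp_rw [Finset.mul_sum]
  rw [integral_finsetSum _ fun k _ => i1 k, integral_finsetSum _ fun k _ => i2 k,
    ← Finset.sum_neg_distrib]
  refine Finset.sum_congr rfl fun k _ => ?_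
  exact integral_mul_fderiv_eq_neg_fderiv_mul_of_integrable (i2 k) (i1 k) (i3 k)
    (fun x _ => hw.differentiable one_ne_zero x) (fun x _ => (hJ k).differentiable one_ne_zero x)

/-- A phase that is positive only inside a ball shrinking at speed comparable to `c`; composed with
a smooth step it gives cutoffs to truncated cones. -/
def conePhase (R c a t : ℝ) (x : E3) : ℝ := R - c * (t - a) - ‖x‖ ^ 2 / R

lemma conePhase_nonpos {R c a t M : ℝ} {x : E3} (hR : 0 < R) (hM : R - c * (t - a) ≤ M)
    (hx : x ∉ Metric.closedBall (0 : E3) (Real.sqrt (R * M))) : conePhase R c a t x ≤ 0 := by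
  have h1 : Real.sqrt (R * M) < ‖x‖ := by simpa using hx
  have h2 : R * M < ‖x‖ ^ 2 := by
    rwa [Real.sqrt_lt' ((Real.sqrt_nonneg _).trans_lt h1)] at h1
  have h3 : M ≤ ‖x‖ ^ 2 / R := by rw [le_div_iff₀ hR]; linarith
  unfold conePhase; linarith

lemma conePhase_continuous (R c a : ℝ) :
    Continuous fun p : ℝ × E3 => conePhase R c a p.1 p.2 := by
  unfold conePhase; fun_prop

lemma cutoff_contDiff (R c a t : ℝ) :
    ContDiff ℝ 1 fun x : E3 => Real.smoothTransition (conePhase R c a t x) := by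
  refine (Real.smoothTransition.contDiff (n := 1)).comp ?_
  unfold conePhase
  exact contDiff_const.sub ((contDiff_norm_sq ℝ).div_const R)

lemma cutoff_fderiv (R c a t : ℝ) (x : E3) (k : Fin 3) :
    fderiv ℝ (fun x : E3 => Real.smoothTransition (conePhase R c a t x)) x
      (EuclideanSpace.single k (1 : ℝ))
      = deriv Real.smoothTransition (conePhase R c a t x) * (-(2 * x k / R)) := by
  have h1 : HasFDerivAt (fun x : E3 => conePhase R c a t x)
      (-((2 • innerSL ℝ x).smulRight (R⁻¹ : ℝ))) x := by
    have := ((hasStrictFDerivAt_norm_sq x).hasFDerivAt.mul_const R⁻¹).const_sub (R - c * (t - a))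
    refine this.congr_fderiv ?_ |>.congr_of_eventuallyEq ?_
    · ext v; simp; ring
    · exact Eventually.of_forall fun y => by simp [conePhase, div_eq_mul_inv]
  have h2 := (smoothTransition_hasDerivAt (conePhase R c a t x)).comp_hasFDerivAt x h1
  have h3 : fderiv ℝ (fun x : E3 => Real.smoothTransition (conePhase R c a t x)) x = _ := h2.fderiv
  rw [h3]
  simp [EuclideanSpace.inner_single_right]
  left; ring

lemma abs_coord_le_norm (x : E3) (k : Fin 3) : |x k| ≤ ‖x‖ := by
  simpa using PiLp.norm_apply_le x k

/-- A nonnegative density with a dominated flux has nonincreasing total integral: the finite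
propagation speed argument needs no uniformity in time of the spatial decay. -/
lemma integral_le_of_conservation {q qt : ℝ → E3 → ℝ} {J : Fin 3 → ℝ → E3 → ℝ} {C : ℝ}
    (hC : 0 < C) (hq : Continuous (Function.uncurry q)) (hqt : Continuous (Function.uncurry qt))
    (hd : ∀ t x, HasDerivAt (fun s => q s x) (qt t x) t)
    (hJ : ∀ k t, ContDiff ℝ 1 (J k t))
    (hcons : ∀ t x, qt t x = -∑ k, fderiv ℝ (J k t) x (EuclideanSpace.single k (1 : ℝ)))
    (hb : ∀ k t x, |J k t x| ≤ C * q t x) (hint : ∀ t, Integrable (q t))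
    {a b : ℝ} (hab : a ≤ b) : ∫ x, q b x ≤ ∫ x, q a x := by
  set c : ℝ := 6 * C with hc
  have hcpos : 0 < c := by positivity
  set g := Real.smoothTransition with hg
  have hq0 : ∀ t x, 0 ≤ q t x := fun t x =>
    nonneg_of_mul_nonneg_right ((abs_nonneg _).trans (hb 0 t x)) hC
  have hqc : ∀ t, Continuous (q t) := fun t => hq.comp (by fun_prop : Continuous fun x => (t, x))
  have key : ∀ R : ℝ, 0 < R → ∫ x, g (conePhase R c a b x) * q b x ≤ ∫ x, q a x := by
    intro R hR
    have hderiv : ∀ t, HasDerivAt (fun t => ∫ x, g (conePhase R c a t x) * q t x)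
        (∫ x, (deriv g (conePhase R c a t x) * (-c) * q t x
          + g (conePhase R c a t x) * qt t x)) t := by
      intro t₀
      have hK : ∀ t ∈ Metric.closedBall t₀ 1, ∀ x ∉ Metric.closedBall (0 : E3)
          (Real.sqrt (R * (R - c * (t₀ - 1 - a)))), conePhase R c a t x ≤ 0 := by
        intro t ht x hx
        refine conePhase_nonpos hR ?_ hx
        rw [Metric.mem_closedBall, Real.dist_eq, abs_le] at ht
        nlinarith
      have hph := conePhase_continuous R c a
      refine hasDerivAt_integral_of_compact
        (f := fun t x => g (conePhase R c a t x) * q t x)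
        (f' := fun t x => deriv g (conePhase R c a t x) * (-c) * q t x
          + g (conePhase R c a t x) * qt t x) ?_ ?_ ?_ t₀
        (isCompact_closedBall (0 : E3) (Real.sqrt (R * (R - c * (t₀ - 1 - a))))) ?_ ?_
      · exact (Real.smoothTransition.continuous.comp hph).mul hq
      · exact (((smoothTransition_continuous_deriv.comp hph).mul continuous_const).mul hq).add
          ((Real.smoothTransition.continuous.comp hph).mul hqt)
      · intro t x
        have h1 : HasDerivAt (fun s => conePhase R c a s x) (-c) t := by
          unfold conePhase
          simpa using ((((hasDerivAt_id t).sub_const a).const_mul c).const_sub R).sub_const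
            (‖x‖ ^ 2 / R)
        exact ((smoothTransition_hasDerivAt _).comp t h1).mul (hd t x)
      · intro x hx
        simp [hg, Real.smoothTransition.zero_of_nonpos
          (hK t₀ (Metric.mem_closedBall_self zero_le_one) x hx)]
      · intro t ht x hx
        simp [hg, Real.smoothTransition.zero_of_nonpos (hK t ht x hx),
          smoothTransition_deriv_eq_zero (hK t ht x hx)]
    have hanti : AntitoneOn (fun t => ∫ x, g (conePhase R c a t x) * q t x) (Set.Icc a b) := by
      refine antitoneOn_of_deriv_nonpos (convex_Icc a b)
        (fun t _ => (hderiv t).continuousAt.continuousWithinAt)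
        (fun t _ => (hderiv t).differentiableAt.differentiableWithinAt) ?_
      intro t ht
      rw [interior_Icc] at ht
      rw [(hderiv t).deriv]
      have hcs : IsCompact (Metric.closedBall (0 : E3) (Real.sqrt (R * R))) :=
        isCompact_closedBall _ _
      have hphx : ∀ x ∉ Metric.closedBall (0 : E3) (Real.sqrt (R * R)),
          conePhase R c a t x ≤ 0 := fun x hx =>
        conePhase_nonpos hR (by nlinarith [ht.1]) hx
      have hpht : Continuous fun x => conePhase R c a t x :=
        (conePhase_continuous R c a).comp (by fun_prop : Continuous fun x => (t, x))
      have hwc : HasCompactSupport fun x => g (conePhase R c a t x) :=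
        HasCompactSupport.intro hcs fun x hx =>
          Real.smoothTransition.zero_of_nonpos (hphx x hx)
      have hwc' : HasCompactSupport fun x => deriv g (conePhase R c a t x) :=
        HasCompactSupport.intro hcs fun x hx => smoothTransition_deriv_eq_zero (hphx x hx)
      have hw := cutoff_contDiff R c a t
      have hqtc : Continuous (qt t) := hqt.comp (by fun_prop : Continuous fun x => (t, x))
      have i1 : Integrable fun x => deriv g (conePhase R c a t x) * (-c) * q t x :=
        (((smoothTransition_continuous_deriv.comp hpht).mul continuous_const).mul
          (hqc t)).integrable_of_hasCompactSupport hwc'.mul_right.mul_right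
      have i2 : Integrable fun x => g (conePhase R c a t x) * qt t x :=
        ((Real.smoothTransition.continuous.comp hpht).mul hqtc).integrable_of_hasCompactSupport
          hwc.mul_right
      have i3 : Integrable fun x => ∑ k, fderiv ℝ (fun x => g (conePhase R c a t x)) x
          (EuclideanSpace.single k (1 : ℝ)) * J k t x := by
        refine integrable_finsetSum _ fun k _ => ?_
        exact (((hw.continuous_fderiv one_ne_zero).clm_apply continuous_const).mul
          (hJ k t).continuous).integrable_of_hasCompactSupport
          (hwc.fderiv_apply (𝕜 := ℝ) _).mul_right
      rw [integral_add i1 i2]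
      have e2 : ∫ x, g (conePhase R c a t x) * qt t x
          = ∫ x, ∑ k, fderiv ℝ (fun x => g (conePhase R c a t x)) x
          (EuclideanSpace.single k (1 : ℝ)) * J k t x := by
        simp_rw [hcons, mul_neg]
        rw [integral_neg, integral_mul_divergence hw hwc (fun k => hJ k t), neg_neg]
      rw [e2, ← integral_add i1 i3]
      refine integral_nonpos fun x => ?_
      simp only [Pi.zero_apply]
      by_cases hx : x ∈ Metric.closedBall (0 : E3) (Real.sqrt (R * R))
      · rw [Real.sqrt_mul_self hR.le, mem_closedBall_zero_iff] at hx
        have hterm : ∀ k, fderiv ℝ (fun x => g (conePhase R c a t x)) x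
            (EuclideanSpace.single k (1 : ℝ)) * J k t x
            ≤ deriv g (conePhase R c a t x) * (2 * (C * q t x)) := by
          intro k
          rw [cutoff_fderiv, mul_assoc]
          refine mul_le_mul_of_nonneg_left ?_ (smoothTransition_deriv_nonneg _)
          refine (le_abs_self _).trans ?_
          rw [abs_mul]
          refine mul_le_mul ?_ (hb k t x) (abs_nonneg _) zero_le_two
          rw [abs_neg, abs_div, abs_mul, abs_two, abs_of_pos hR, div_le_iff₀ hR]
          linarith [abs_coord_le_norm x k]
        have := Finset.sum_le_sum fun k (_ : k ∈ Finset.univ) => hterm k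
        rw [Finset.sum_const, Finset.card_univ, Fintype.card_fin] at this
        simp only [nsmul_eq_mul, Nat.cast_ofNat] at this
        rw [hc]
        linarith
      · have hz := smoothTransition_deriv_eq_zero (hphx x hx)
        simp [hg, cutoff_fderiv, hz]
    have h1 := hanti (Set.left_mem_Icc.2 hab) (Set.right_mem_Icc.2 hab) hab
    refine h1.trans ?_
    refine integral_mono_of_nonneg (ae_of_all _ fun x =>
      mul_nonneg (Real.smoothTransition.nonneg _) (hq0 a x)) (hint a) (ae_of_all _ fun x => ?_)
    exact mul_le_of_le_one_left (hq0 a x) (Real.smoothTransition.le_one _)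
  have hlim : Tendsto (fun R => ∫ x, g (conePhase R c a b x) * q b x) atTop
      (𝓝 (∫ x, q b x)) := by
    refine tendsto_integral_filter_of_dominated_convergence (q b) ?_ ?_ (hint b) ?_
    · refine Eventually.of_forall fun R => Continuous.aestronglyMeasurable ?_
      have hpht : Continuous fun x => conePhase R c a b x :=
        (conePhase_continuous R c a).comp (by fun_prop : Continuous fun x => (b, x))
      exact (Real.smoothTransition.continuous.comp hpht).mul (hqc b)
    · refine Eventually.of_forall fun R => ae_of_all _ fun x => ?_
      rw [Real.norm_eq_abs, abs_of_nonneg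
        (mul_nonneg (Real.smoothTransition.nonneg _) (hq0 b x))]
      exact mul_le_of_le_one_left (hq0 b x) (Real.smoothTransition.le_one _)
    · refine ae_of_all _ fun x => tendsto_const_nhds.congr' ?_
      filter_upwards [eventually_ge_atTop (1 + c * (b - a) + ‖x‖ ^ 2), eventually_ge_atTop 1]
        with R h1 h2
      have h3 : ‖x‖ ^ 2 / R ≤ ‖x‖ ^ 2 := div_le_self (by positivity) h2
      have : 1 ≤ conePhase R c a b x := by unfold conePhase; linarith
      rw [hg, Real.smoothTransition.one_of_one_le this, one_mul]
  exact le_of_tendsto hlim ((eventually_gt_atTop 0).mono fun R hR => key R hR)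

/-- A nonnegative density with a dominated flux has constant total integral. -/
lemma integral_eq_of_conservation {q qt : ℝ → E3 → ℝ} {J : Fin 3 → ℝ → E3 → ℝ} {C : ℝ}
    (hC : 0 < C) (hq : Continuous (Function.uncurry q)) (hqt : Continuous (Function.uncurry qt))
    (hd : ∀ t x, HasDerivAt (fun s => q s x) (qt t x) t)
    (hJ : ∀ k t, ContDiff ℝ 1 (J k t))
    (hcons : ∀ t x, qt t x = -∑ k, fderiv ℝ (J k t) x (EuclideanSpace.single k (1 : ℝ)))
    (hb : ∀ k t x, |J k t x| ≤ C * q t x) (hint : ∀ t, Integrable (q t))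
    (a b : ℝ) : ∫ x, q a x = ∫ x, q b x := by
  wlog hab : a ≤ b generalizing a b
  · exact (this b a (le_of_not_ge hab)).symm
  refine le_antisymm ?_ (integral_le_of_conservation hC hq hqt hd hJ hcons hb hint hab)
  have hneg : Continuous fun p : ℝ × E3 => (-p.1, p.2) := by fun_prop
  have := integral_le_of_conservation (q := fun t => q (-t)) (qt := fun t x => -qt (-t) x)
    (J := fun k t x => -J k (-t) x) hC (hq.comp hneg) (hqt.comp hneg).neg
    (fun t x => by simpa using! (hd (-t) x).scomp t (hasDerivAt_neg t))
    (fun k t => (hJ k (-t)).neg) (fun t x => by simp [hcons, fderiv_fun_neg])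
    (fun k t x => by simpa using hb k (-t) x) (fun t => hint (-t)) (neg_le_neg hab)
  simpa using this

/-- The derivative of a function on spacetime in the direction `v`. -/
def dirDeriv (v : ℝ × E3) (f : ℝ × E3 → ℝ) (p : ℝ × E3) : ℝ := fderiv ℝ f p v

/-- The unit vector in the time direction. -/
def timeVec : ℝ × E3 := (1, 0)

/-- The unit vector in the `k`-th spatial direction. -/
def spaceVec (k : Fin 3) : ℝ × E3 := (0, EuclideanSpace.single k 1)

/-- Every time slice of `f` is a Schwartz function. -/
def SchwartzSlices (f : ℝ × E3 → ℝ) : Prop :=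
  ∀ t : ℝ, ∃ g : SchwartzMap E3 ℝ, ∀ x, g x = f (t, x)

/-- The wave operator part of the Klein-Gordon equation together with smoothness and decay, in
terms of directional derivatives on spacetime. -/
structure KGSol (m : ℝ) (V : Polynomial ℝ) (u : ℝ × E3 → ℝ) : Prop where
  smooth : ContDiff ℝ (⊤ : ℕ∞) u
  eqn : ∀ p, dirDeriv timeVec (dirDeriv timeVec u) p
    - ∑ k, dirDeriv (spaceVec k) (dirDeriv (spaceVec k) u) p
    + m ^ 2 * u p + (derivative V).eval (u p) = 0
  slices : SchwartzSlices u
  slices_time : SchwartzSlices (dirDeriv timeVec u)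

section dirDeriv

variable {f g : ℝ × E3 → ℝ}

lemma dirDeriv_contDiff (hf : ContDiff ℝ (⊤ : ℕ∞) f) (v : ℝ × E3) :
    ContDiff ℝ (⊤ : ℕ∞) (dirDeriv v f) :=
  (hf.fderiv_right (m := ((⊤ : ℕ∞) : WithTop ℕ∞)) (by norm_cast)).clm_apply contDiff_const

lemma smooth_hasFDerivAt (hf : ContDiff ℝ (⊤ : ℕ∞) f) (p : ℝ × E3) :
    HasFDerivAt f (fderiv ℝ f p) p :=
  (hf.differentiable (by simp) p).hasFDerivAt

lemma hasDerivAt_line (hf : ContDiff ℝ (⊤ : ℕ∞) f) (v p : ℝ × E3) :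
    HasDerivAt (fun s : ℝ => f (p + s • v)) (dirDeriv v f p) 0 :=
  (smooth_hasFDerivAt hf p).hasLineDerivAt v

lemma dirDeriv_eq_of_hasDerivAt (hf : ContDiff ℝ (⊤ : ℕ∞) f) {v p : ℝ × E3} {d : ℝ}
    (h : HasDerivAt (fun s : ℝ => f (p + s • v)) d 0) : dirDeriv v f p = d :=
  (hasDerivAt_line hf v p).unique h

lemma dirDeriv_comm (hf : ContDiff ℝ (⊤ : ℕ∞) f) (v w p : ℝ × E3) :
    dirDeriv v (dirDeriv w f) p = dirDeriv w (dirDeriv v f) p := by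
  have hd : DifferentiableAt ℝ (fderiv ℝ f) p :=
    (hf.fderiv_right (m := ((⊤ : ℕ∞) : WithTop ℕ∞)) (by norm_cast)).differentiable (by simp) p
  have h : ∀ v w, dirDeriv v (dirDeriv w f) p = fderiv ℝ (fderiv ℝ f) p v w := by
    intro v w
    have := hd.hasFDerivAt.clm_apply (hasFDerivAt_const w p)
    have h2 : fderiv ℝ (dirDeriv w f) p = _ := this.fderiv
    rw [dirDeriv, h2]
    simp
  rw [h, h]
  exact (hf.contDiffAt.of_le (m := 2) (by norm_cast)
    |>.isSymmSndFDerivAt (by simp)).eq v w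

lemma hasDerivAt_time (hf : ContDiff ℝ (⊤ : ℕ∞) f) (t : ℝ) (x : E3) :
    HasDerivAt (fun s => f (s, x)) (dirDeriv timeVec f (t, x)) t :=
  (smooth_hasFDerivAt hf (t, x)).comp_hasDerivAt t
    ((hasDerivAt_id t).prodMk (hasDerivAt_const t x))

lemma fderiv_slice (hf : ContDiff ℝ (⊤ : ℕ∞) f) (t : ℝ) (x : E3) (k : Fin 3) :
    fderiv ℝ (fun y => f (t, y)) x (EuclideanSpace.single k (1 : ℝ))
      = dirDeriv (spaceVec k) f (t, x) := by
  have h := (smooth_hasFDerivAt hf (t, x)).comp x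
    ((hasFDerivAt_const t x).prodMk (hasFDerivAt_id x))
  have h2 : fderiv ℝ (fun y => f (t, y)) x = _ := h.fderiv
  rw [h2]
  simp [dirDeriv, spaceVec]

lemma timeDeriv_eq (hf : ContDiff ℝ (⊤ : ℕ∞) f) (t : ℝ) (x : E3) :
    timeDeriv f t x = dirDeriv timeVec f (t, x) :=
  (hasDerivAt_time hf t x).deriv

lemma pderiv3_eq (hf : ContDiff ℝ (⊤ : ℕ∞) f) (k : Fin 3) (t : ℝ) (x : E3) :
    pderiv3 k (fun y => f (t, y)) x = dirDeriv (spaceVec k) f (t, x) :=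
  fderiv_slice hf t x k

lemma iteratedDeriv_two_time (hf : ContDiff ℝ (⊤ : ℕ∞) f) (t : ℝ) (x : E3) :
    iteratedDeriv 2 (fun s => f (s, x)) t = dirDeriv timeVec (dirDeriv timeVec f) (t, x) := by
  have h1 : deriv (fun s => f (s, x)) = fun s => dirDeriv timeVec f (s, x) :=
    funext fun s => (hasDerivAt_time hf s x).deriv
  rw [iteratedDeriv_succ, iteratedDeriv_one, h1]
  exact (hasDerivAt_time (dirDeriv_contDiff hf _) t x).deriv

lemma lapl_slice (hf : ContDiff ℝ (⊤ : ℕ∞) f) (t : ℝ) (x : E3) :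
    lapl (fun y => f (t, y)) x
      = ∑ k, dirDeriv (spaceVec k) (dirDeriv (spaceVec k) f) (t, x) := by
  refine Finset.sum_congr rfl fun k _ => ?_
  have key : ∀ {g : ℝ × E3 → ℝ}, ContDiff ℝ (⊤ : ℕ∞) g → ∀ s : ℝ,
      HasDerivAt (fun s : ℝ => g (t, x + s • EuclideanSpace.single k (1 : ℝ)))
        (dirDeriv (spaceVec k) g (t, x + s • EuclideanSpace.single k (1 : ℝ))) s := by
    intro g hg s
    have h : HasDerivAt (fun s : ℝ => (t, x + s • EuclideanSpace.single k (1 : ℝ)))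
        (spaceVec k) s := by
      refine (hasDerivAt_const s t).prodMk ?_
      simpa using ((hasDerivAt_id s).smul_const (EuclideanSpace.single k (1 : ℝ))).const_add x
    exact (smooth_hasFDerivAt hg _).comp_hasDerivAt s h
  rw [iteratedDeriv_succ, iteratedDeriv_one,
    show deriv (fun s : ℝ => f (t, x + s • EuclideanSpace.single k (1 : ℝ))) = _ from
      funext fun s => (key hf s).deriv, (key (dirDeriv_contDiff hf _) 0).deriv]
  simp

lemma SchwartzSlices.space (hs : SchwartzSlices f) (hf : ContDiff ℝ (⊤ : ℕ∞) f) (k : Fin 3) :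
    SchwartzSlices (dirDeriv (spaceVec k) f) := by
  intro t
  obtain ⟨g, hg⟩ := hs t
  refine ⟨LineDeriv.lineDerivOp (EuclideanSpace.single k (1 : ℝ)) g, fun x => ?_⟩
  rw [SchwartzMap.lineDerivOp_apply_eq_fderiv, ← fderiv_slice hf, ← funext hg]

lemma SchwartzSlices.memLp (hs : SchwartzSlices f) (t : ℝ) :
    MemLp (fun x => f (t, x)) 2 volume := by
  obtain ⟨g, hg⟩ := hs t
  rw [← funext hg]
  exact g.memLp 2

lemma SchwartzSlices.integrable_mul (hs : SchwartzSlices f) (hs' : SchwartzSlices g) (t : ℝ) :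
    Integrable fun x => f (t, x) * g (t, x) :=
  (hs.memLp t).integrable_mul (hs'.memLp t)

lemma SchwartzSlices.integrable_eval (hs : SchwartzSlices f) {V : Polynomial ℝ}
    (hV : V.eval 0 = 0) (t : ℝ) : Integrable fun x => V.eval (f (t, x)) := by
  obtain ⟨g, hg⟩ := hs t
  simp_rw [← hg]
  obtain ⟨B, hB⟩ : ∃ B, ∀ x, |g x| ≤ B := ⟨_, fun x => SchwartzMap.norm_le_seminorm ℝ g x⟩
  have hW : Continuous fun s => V.divX.eval s := V.divX.continuous
  obtain ⟨M, hM⟩ := (isCompact_Icc (a := -B) (b := B)).exists_bound_of_continuousOn hW.continuousOn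
  have hfac : ∀ s, V.eval s = V.divX.eval s * s := by
    intro s
    conv_lhs => rw [← V.divX_mul_X_add]
    simp [coeff_zero_eq_eval_zero, hV]
  simp_rw [hfac]
  exact g.integrable.bdd_mul (hW.comp g.continuous).aestronglyMeasurable
    (ae_of_all _ fun x => hM _ (abs_le.1 (hB x)))

end dirDeriv

lemma IsGlobalSol.kgSol {m : ℝ} {V : Polynomial ℝ} {u : ℝ × E3 → ℝ} (h : IsGlobalSol m V u) :
    KGSol m V u := by
  obtain ⟨h1, h2, h3, h4⟩ := h
  refine ⟨h1, fun p => ?_, h3, fun t => ?_⟩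
  · have := h2 p.1 p.2
    rwa [iteratedDeriv_two_time h1, lapl_slice h1] at this
  · obtain ⟨g, hg⟩ := h4 t
    exact ⟨g, fun x => (hg x).trans (timeDeriv_eq h1 t x)⟩

lemma dirDeriv_linear_wave {m : ℝ} {u : ℝ × E3 → ℝ} (hu : ContDiff ℝ (⊤ : ℕ∞) u)
    (v p : ℝ × E3) :
    dirDeriv v (fun p => dirDeriv timeVec (dirDeriv timeVec u) p
      - ∑ k, dirDeriv (spaceVec k) (dirDeriv (spaceVec k) u) p + m ^ 2 * u p) p
    = dirDeriv timeVec (dirDeriv timeVec (dirDeriv v u)) p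
      - ∑ k, dirDeriv (spaceVec k) (dirDeriv (spaceVec k) (dirDeriv v u)) p
      + m ^ 2 * dirDeriv v u p := by
  have hc : ∀ w, dirDeriv v (dirDeriv w (dirDeriv w u)) p
      = dirDeriv w (dirDeriv w (dirDeriv v u)) p := by
    intro w
    rw [dirDeriv_comm (dirDeriv_contDiff hu w) v w]
    congr 1
    exact funext fun p => dirDeriv_comm hu v w p
  have h2 : ∀ w, ContDiff ℝ (⊤ : ℕ∞) (dirDeriv w (dirDeriv w u)) := fun w =>
    dirDeriv_contDiff (dirDeriv_contDiff hu w) w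
  refine dirDeriv_eq_of_hasDerivAt
    (((h2 _).sub (ContDiff.sum fun k _ => h2 _)).add (contDiff_const.mul hu)) ?_
  simp_rw [← hc]
  exact ((hasDerivAt_line (h2 _) v p).sub
    (HasDerivAt.fun_sum fun k _ => hasDerivAt_line (h2 (spaceVec k)) v p)).add
    ((hasDerivAt_line hu v p).const_mul _)

/-- Spatial derivatives of free solutions are free solutions. -/
lemma KGSol.space_deriv {m : ℝ} {u : ℝ × E3 → ℝ} (h : KGSol m 0 u) (j : Fin 3) :
    KGSol m 0 (dirDeriv (spaceVec j) u) := by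
  refine ⟨dirDeriv_contDiff h.smooth _, fun p => ?_, h.slices.space h.smooth j, ?_⟩
  · rw [← dirDeriv_linear_wave h.smooth]
    have h0 : (fun p => dirDeriv timeVec (dirDeriv timeVec u) p
      - ∑ k, dirDeriv (spaceVec k) (dirDeriv (spaceVec k) u) p + m ^ 2 * u p) = fun _ => 0 :=
      funext fun p => by simpa using h.eqn p
    rw [h0]
    simp [dirDeriv]
  · rw [show dirDeriv timeVec (dirDeriv (spaceVec j) u)
      = dirDeriv (spaceVec j) (dirDeriv timeVec u) from
      funext fun p => dirDeriv_comm h.smooth _ _ p]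
    exact h.slices_time.space (dirDeriv_contDiff h.smooth _) j

/-- The potential energy density `½ m² u² + V(u)`. -/
def potDensity (m : ℝ) (V : Polynomial ℝ) (u : ℝ × E3 → ℝ) (p : ℝ × E3) : ℝ :=
  m ^ 2 / 2 * (u p * u p) + V.eval (u p)

/-- The sum of the squares of the spatial derivatives. -/
def gradSq (u : ℝ × E3 → ℝ) (p : ℝ × E3) : ℝ :=
  ∑ k, dirDeriv (spaceVec k) u p * dirDeriv (spaceVec k) u p

/-- The energy density plus `a` times the density of the `j`-th momentum. -/
def emDensity (m : ℝ) (V : Polynomial ℝ) (u : ℝ × E3 → ℝ) (a : ℝ) (j : Fin 3) (p : ℝ × E3) : ℝ :=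
  1 / 2 * (dirDeriv timeVec u p * dirDeriv timeVec u p) + 1 / 2 * gradSq u p + potDensity m V u p
    + a * (dirDeriv timeVec u p * dirDeriv (spaceVec j) u p)

/-- The Lagrangian density. -/
def lagrangian (m : ℝ) (V : Polynomial ℝ) (u : ℝ × E3 → ℝ) (p : ℝ × E3) : ℝ :=
  1 / 2 * (dirDeriv timeVec u p * dirDeriv timeVec u p) - 1 / 2 * gradSq u p - potDensity m V u p

/-- The flux of `emDensity`. -/
def emFlux (m : ℝ) (V : Polynomial ℝ) (u : ℝ × E3 → ℝ) (a : ℝ) (j k : Fin 3) (p : ℝ × E3) : ℝ :=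
  -(dirDeriv timeVec u p * dirDeriv (spaceVec k) u p)
    - a * (dirDeriv (spaceVec k) u p * dirDeriv (spaceVec j) u p
      + (if k = j then 1 else 0) * lagrangian m V u p)

section Density

variable {m : ℝ} {V : Polynomial ℝ} {u : ℝ × E3 → ℝ}

lemma polynomial_comp_contDiff (hu : ContDiff ℝ (⊤ : ℕ∞) u) :
    ContDiff ℝ (⊤ : ℕ∞) fun p => V.eval (u p) :=
  (by simpa using V.contDiff_aeval (𝕜 := ℝ) (⊤ : ℕ∞) :
    ContDiff ℝ (⊤ : ℕ∞) fun x => V.eval x).comp hu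

lemma potDensity_contDiff (hu : ContDiff ℝ (⊤ : ℕ∞) u) :
    ContDiff ℝ (⊤ : ℕ∞) (potDensity m V u) :=
  (contDiff_const.mul (hu.mul hu)).add (polynomial_comp_contDiff hu)

lemma gradSq_contDiff (hu : ContDiff ℝ (⊤ : ℕ∞) u) : ContDiff ℝ (⊤ : ℕ∞) (gradSq u) :=
  ContDiff.sum fun _ _ => (dirDeriv_contDiff hu _).mul (dirDeriv_contDiff hu _)

lemma emDensity_contDiff (hu : ContDiff ℝ (⊤ : ℕ∞) u) (a : ℝ) (j : Fin 3) :
    ContDiff ℝ (⊤ : ℕ∞) (emDensity m V u a j) :=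
  (((contDiff_const.mul ((dirDeriv_contDiff hu _).mul (dirDeriv_contDiff hu _))).add
    (contDiff_const.mul (gradSq_contDiff hu))).add (potDensity_contDiff hu)).add
    (contDiff_const.mul ((dirDeriv_contDiff hu _).mul (dirDeriv_contDiff hu _)))

lemma lagrangian_contDiff (hu : ContDiff ℝ (⊤ : ℕ∞) u) :
    ContDiff ℝ (⊤ : ℕ∞) (lagrangian m V u) :=
  ((contDiff_const.mul ((dirDeriv_contDiff hu _).mul (dirDeriv_contDiff hu _))).sub
    (contDiff_const.mul (gradSq_contDiff hu))).sub (potDensity_contDiff hu)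

lemma emFlux_contDiff (hu : ContDiff ℝ (⊤ : ℕ∞) u) (a : ℝ) (j k : Fin 3) :
    ContDiff ℝ (⊤ : ℕ∞) (emFlux m V u a j k) :=
  ((dirDeriv_contDiff hu _).mul (dirDeriv_contDiff hu _)).neg.sub
    (contDiff_const.mul (((dirDeriv_contDiff hu _).mul (dirDeriv_contDiff hu _)).add
      (contDiff_const.mul (lagrangian_contDiff hu))))

lemma dirDeriv_potDensity (hu : ContDiff ℝ (⊤ : ℕ∞) u) (v p : ℝ × E3) :
    dirDeriv v (potDensity m V u) p
      = (m ^ 2 * u p + (derivative V).eval (u p)) * dirDeriv v u p := by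
  refine dirDeriv_eq_of_hasDerivAt (potDensity_contDiff hu) ?_
  have h := hasDerivAt_line hu v p
  have hV : HasDerivAt (fun s : ℝ => V.eval (u (p + s • v))) _ 0 :=
    (V.hasDerivAt _).comp 0 h
  refine (((h.mul h).const_mul (m ^ 2 / 2)).add hV).congr_deriv ?_
  simp only [zero_smul, add_zero]
  ring

lemma dirDeriv_gradSq (hu : ContDiff ℝ (⊤ : ℕ∞) u) (v p : ℝ × E3) :
    dirDeriv v (gradSq u) p
      = 2 * ∑ k, dirDeriv (spaceVec k) u p * dirDeriv v (dirDeriv (spaceVec k) u) p := by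
  refine dirDeriv_eq_of_hasDerivAt (gradSq_contDiff hu) ?_
  have h := fun k => hasDerivAt_line (dirDeriv_contDiff hu (spaceVec k)) v p
  refine (HasDerivAt.fun_sum fun k _ => (h k).mul (h k)).congr_deriv ?_
  simp only [zero_smul, add_zero, Finset.mul_sum]
  exact Finset.sum_congr rfl fun k _ => by ring

lemma dirDeriv_emDensity (hu : ContDiff ℝ (⊤ : ℕ∞) u) (a : ℝ) (j : Fin 3) (v p : ℝ × E3) :
    dirDeriv v (emDensity m V u a j) p
      = dirDeriv timeVec u p * dirDeriv v (dirDeriv timeVec u) p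
        + ∑ k, dirDeriv (spaceVec k) u p * dirDeriv v (dirDeriv (spaceVec k) u) p
        + (m ^ 2 * u p + (derivative V).eval (u p)) * dirDeriv v u p
        + a * (dirDeriv v (dirDeriv timeVec u) p * dirDeriv (spaceVec j) u p
          + dirDeriv timeVec u p * dirDeriv v (dirDeriv (spaceVec j) u) p) := by
  refine dirDeriv_eq_of_hasDerivAt (emDensity_contDiff hu a j) ?_
  have ht := hasDerivAt_line (dirDeriv_contDiff hu timeVec) v p
  have hj := hasDerivAt_line (dirDeriv_contDiff hu (spaceVec j)) v p
  refine (((((ht.mul ht).const_mul (1 / 2)).add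
    ((hasDerivAt_line (gradSq_contDiff hu) v p).const_mul (1 / 2))).add
    (hasDerivAt_line (potDensity_contDiff hu) v p)).add ((ht.mul hj).const_mul a)).congr_deriv ?_
  simp only [zero_smul, add_zero, dirDeriv_potDensity hu, dirDeriv_gradSq hu]
  ring

lemma dirDeriv_lagrangian (hu : ContDiff ℝ (⊤ : ℕ∞) u) (v p : ℝ × E3) :
    dirDeriv v (lagrangian m V u) p
      = dirDeriv timeVec u p * dirDeriv v (dirDeriv timeVec u) p
        - ∑ k, dirDeriv (spaceVec k) u p * dirDeriv v (dirDeriv (spaceVec k) u) p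
        - (m ^ 2 * u p + (derivative V).eval (u p)) * dirDeriv v u p := by
  refine dirDeriv_eq_of_hasDerivAt (lagrangian_contDiff hu) ?_
  have ht := hasDerivAt_line (dirDeriv_contDiff hu timeVec) v p
  refine ((((ht.mul ht).const_mul (1 / 2)).sub
    ((hasDerivAt_line (gradSq_contDiff hu) v p).const_mul (1 / 2))).sub
    (hasDerivAt_line (potDensity_contDiff hu) v p)).congr_deriv ?_
  simp only [zero_smul, add_zero, dirDeriv_potDensity hu, dirDeriv_gradSq hu]
  ring

lemma dirDeriv_emFlux (hu : ContDiff ℝ (⊤ : ℕ∞) u) (a : ℝ) (j k : Fin 3) (v p : ℝ × E3) :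
    dirDeriv v (emFlux m V u a j k) p
      = -(dirDeriv v (dirDeriv timeVec u) p * dirDeriv (spaceVec k) u p
          + dirDeriv timeVec u p * dirDeriv v (dirDeriv (spaceVec k) u) p)
        - a * (dirDeriv v (dirDeriv (spaceVec k) u) p * dirDeriv (spaceVec j) u p
          + dirDeriv (spaceVec k) u p * dirDeriv v (dirDeriv (spaceVec j) u) p
          + (if k = j then 1 else 0) * dirDeriv v (lagrangian m V u) p) := by
  refine dirDeriv_eq_of_hasDerivAt (emFlux_contDiff hu a j k) ?_
  have ht := hasDerivAt_line (dirDeriv_contDiff hu timeVec) v p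
  have hs := fun j => hasDerivAt_line (dirDeriv_contDiff hu (spaceVec j)) v p
  refine (((ht.mul (hs k)).neg).sub ((((hs k).mul (hs j)).add
    ((hasDerivAt_line (lagrangian_contDiff hu) v p).const_mul _)).const_mul a)).congr_deriv ?_
  simp only [zero_smul, add_zero]

/-- The local conservation law for energy and momentum. -/
lemma KGSol.conservation (h : KGSol m V u) (a : ℝ) (j : Fin 3) (p : ℝ × E3) :
    dirDeriv timeVec (emDensity m V u a j) p
      = -∑ k, dirDeriv (spaceVec k) (emFlux m V u a j k) p := by
  have hu := h.smooth
  have he := h.eqn p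
  have hc : ∀ k, dirDeriv timeVec (dirDeriv (spaceVec k) u) p
      = dirDeriv (spaceVec k) (dirDeriv timeVec u) p := fun k => dirDeriv_comm hu _ _ p
  have hs : ∀ k, dirDeriv (spaceVec k) (dirDeriv (spaceVec j) u) p
      = dirDeriv (spaceVec j) (dirDeriv (spaceVec k) u) p := fun k => dirDeriv_comm hu _ _ p
  simp only [dirDeriv_emDensity hu, dirDeriv_emFlux hu, dirDeriv_lagrangian hu, hc, hs, ite_mul,
    one_mul, zero_mul, Finset.sum_sub_distrib, Finset.sum_add_distrib, Finset.sum_neg_distrib,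
    ← Finset.mul_sum, ← Finset.sum_mul, Finset.sum_ite_eq', Finset.mem_univ, if_true]
  have e1 : ∑ k, dirDeriv (spaceVec k) (dirDeriv timeVec u) p * dirDeriv (spaceVec k) u p
      = ∑ k, dirDeriv (spaceVec k) u p * dirDeriv (spaceVec k) (dirDeriv timeVec u) p :=
    Finset.sum_congr rfl fun k _ => mul_comm _ _
  rw [e1]
  linear_combination (dirDeriv timeVec u p + a * dirDeriv (spaceVec j) u p) * he

lemma sq_le_gradSq (k : Fin 3) (p : ℝ × E3) : dirDeriv (spaceVec k) u p ^ 2 ≤ gradSq u p := by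
  rw [sq]
  exact Finset.single_le_sum (f := fun k => dirDeriv (spaceVec k) u p * dirDeriv (spaceVec k) u p)
    (fun i _ => mul_self_nonneg _) (Finset.mem_univ k)

lemma potDensity_nonneg (hV : ∀ s, 0 ≤ V.eval s) (p : ℝ × E3) : 0 ≤ potDensity m V u p :=
  add_nonneg (mul_nonneg (by positivity) (mul_self_nonneg _)) (hV _)

lemma abs_emFlux_le (hV : ∀ s, 0 ≤ V.eval s) {a : ℝ} (ha : |a| ≤ 1 / 2) (j k : Fin 3)
    (p : ℝ × E3) : |emFlux m V u a j k p| ≤ 5 * emDensity m V u a j p := by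
  have hN := potDensity_nonneg (m := m) (u := u) hV p
  have hA := sq_le_gradSq (u := u) k p
  have hB := sq_le_gradSq (u := u) j p
  unfold emFlux emDensity lagrangian
  generalize dirDeriv timeVec u p = T at *
  generalize dirDeriv (spaceVec k) u p = A at *
  generalize dirDeriv (spaceVec j) u p = B at *
  generalize gradSq u p = S at *
  generalize potDensity m V u p = N at *
  set d : ℝ := if k = j then 1 else 0 with hd
  have hd1 : |d| ≤ 1 := by rw [hd]; split_ifs <;> simp
  have hTA : |T * A| ≤ (T ^ 2 + S) / 2 := by
    rw [abs_le]; constructor <;> nlinarith [sq_nonneg (T + A), sq_nonneg (T - A)]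
  have hTB : |T * B| ≤ (T ^ 2 + S) / 2 := by
    rw [abs_le]; constructor <;> nlinarith [sq_nonneg (T + B), sq_nonneg (T - B)]
  have hAB : |A * B| ≤ S := by
    rw [abs_le]; constructor <;> nlinarith [sq_nonneg (A + B), sq_nonneg (A - B)]
  have hL : |1 / 2 * (T * T) - 1 / 2 * S - N| ≤ (T ^ 2 + S) / 2 + N := by
    rw [abs_le]; constructor <;> nlinarith [sq_nonneg A]
  have hdL : |d * (1 / 2 * (T * T) - 1 / 2 * S - N)| ≤ (T ^ 2 + S) / 2 + N := by
    rw [abs_mul]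
    exact (mul_le_of_le_one_left (abs_nonneg _) hd1).trans hL
  have haF : |a * (A * B + d * (1 / 2 * (T * T) - 1 / 2 * S - N))|
      ≤ 1 / 2 * (S + ((T ^ 2 + S) / 2 + N)) := by
    rw [abs_mul]
    exact mul_le_mul ha ((abs_add_le _ _).trans (add_le_add hAB hdL)) (abs_nonneg _) (by norm_num)
  have haTB : |a * (T * B)| ≤ 1 / 2 * ((T ^ 2 + S) / 2) := by
    rw [abs_mul]
    exact mul_le_mul ha hTB (abs_nonneg _) (by norm_num)
  rw [abs_le] at *
  constructor <;> nlinarith [haTB.1, haF.1, haF.2, hTA.1, hTA.2, sq_nonneg T, sq_nonneg A]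

lemma KGSol.integrable_emDensity (h : KGSol m V u) (hV : V.eval 0 = 0) (a : ℝ) (j : Fin 3)
    (t : ℝ) : Integrable fun x => emDensity m V u a j (t, x) := by
  have hs := fun k => h.slices.space h.smooth k
  exact ((((h.slices_time.integrable_mul h.slices_time t).const_mul _).add
    ((integrable_finsetSum _ fun k _ => (hs k).integrable_mul (hs k) t).const_mul _)).add
    (((h.slices.integrable_mul h.slices t).const_mul _).add
      (h.slices.integrable_eval hV t))).add
    ((h.slices_time.integrable_mul (hs j) t).const_mul _)

lemma KGSol.integral_emDensity_eq (h : KGSol m V u) (hV0 : V.eval 0 = 0)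
    (hV : ∀ s, 0 ≤ V.eval s) {a : ℝ} (ha : |a| ≤ 1 / 2) (j : Fin 3) (t s : ℝ) :
    ∫ x, emDensity m V u a j (t, x) = ∫ x, emDensity m V u a j (s, x) := by
  have hq := emDensity_contDiff (m := m) (V := V) h.smooth a j
  refine integral_eq_of_conservation (q := fun t x => emDensity m V u a j (t, x))
    (qt := fun t x => dirDeriv timeVec (emDensity m V u a j) (t, x))
    (J := fun k t x => emFlux m V u a j k (t, x)) (C := 5) (by norm_num)
    hq.continuous (dirDeriv_contDiff hq _).continuous (fun t x => hasDerivAt_time hq t x)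
    (fun k t => ?_) (fun t x => ?_) (fun k t x => abs_emFlux_le hV ha j k _)
    (fun t => h.integrable_emDensity hV0 a j t) t s
  · exact ((emFlux_contDiff h.smooth a j k).comp
      (contDiff_const.prodMk contDiff_id)).of_le (by norm_cast)
  · rw [h.conservation]
    simp_rw [fderiv_slice (emFlux_contDiff h.smooth a j _)]

/-- Conservation of momentum. -/
lemma KGSol.momentum_eq (h : KGSol m V u) (hV0 : V.eval 0 = 0) (hV : ∀ s, 0 ≤ V.eval s)
    (j : Fin 3) (t s : ℝ) :
    ∫ x, dirDeriv timeVec u (t, x) * dirDeriv (spaceVec j) u (t, x)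
      = ∫ x, dirDeriv timeVec u (s, x) * dirDeriv (spaceVec j) u (s, x) := by
  have key : ∀ t, ∫ x, emDensity m V u (1 / 2) j (t, x) = (∫ x, emDensity m V u 0 j (t, x))
      + 1 / 2 * ∫ x, dirDeriv timeVec u (t, x) * dirDeriv (spaceVec j) u (t, x) := by
    intro t
    rw [← integral_const_mul, ← integral_add (h.integrable_emDensity hV0 0 j t)
      ((h.slices_time.integrable_mul (h.slices.space h.smooth j) t).const_mul _)]
    simp [emDensity]
  have h1 := h.integral_emDensity_eq hV0 hV (a := 1 / 2) (by norm_num [abs_le]) j t s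
  have h2 := h.integral_emDensity_eq hV0 hV (a := 0) (by norm_num) j t s
  rw [key, key, h2] at h1
  linarith

/-- The `L²` norms of all first derivatives are bounded uniformly in time. -/
lemma KGSol.exists_eLpNorm_le (h : KGSol m V u) (hV0 : V.eval 0 = 0) (hV : ∀ s, 0 ≤ V.eval s) :
    ∃ M : ℝ, (∀ k t, eLpNorm (fun x => dirDeriv (spaceVec k) u (t, x)) 2 volume
        ≤ ENNReal.ofReal M) ∧
      ∀ t, eLpNorm (fun x => dirDeriv timeVec u (t, x)) 2 volume ≤ ENNReal.ofReal M := by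
  set B : ℝ := 2 * ∫ x, emDensity m V u 0 0 (0, x) with hB
  have key : ∀ f : ℝ × E3 → ℝ, SchwartzSlices f →
      (∀ p, f p ^ 2 ≤ 2 * emDensity m V u 0 0 p) → ∀ t,
      eLpNorm (fun x => f (t, x)) 2 volume ≤ ENNReal.ofReal (B ^ (2⁻¹ : ℝ)) := by
    intro f hf hle t
    rw [(hf.memLp t).eLpNorm_eq_integral_rpow_norm two_ne_zero ENNReal.ofNat_ne_top]
    refine ENNReal.ofReal_le_ofReal ?_
    simp only [ENNReal.toReal_ofNat]
    refine Real.rpow_le_rpow (integral_nonneg fun x => by positivity) ?_ (by norm_num)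
    rw [hB, ← h.integral_emDensity_eq hV0 hV (a := 0) (by norm_num) 0 t 0, ← integral_const_mul]
    refine integral_mono_of_nonneg (ae_of_all _ fun x => by positivity)
      ((h.integrable_emDensity hV0 0 0 t).const_mul 2) (ae_of_all _ fun x => ?_)
    simpa using hle (t, x)
  refine ⟨B ^ (2⁻¹ : ℝ), fun k t => key _ (h.slices.space h.smooth k) (fun p => ?_) t,
    fun t => key _ h.slices_time (fun p => ?_) t⟩
  · unfold emDensity
    nlinarith [sq_le_gradSq (u := u) k p, potDensity_nonneg (m := m) (u := u) hV p,
      sq_nonneg (dirDeriv timeVec u p)]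
  · unfold emDensity
    nlinarith [sq_le_gradSq (u := u) 0 p, potDensity_nonneg (m := m) (u := u) hV p,
      sq_nonneg (dirDeriv (spaceVec 0) u p)]

end Density

/-- The Cauchy-Schwarz inequality in terms of extended norms. -/
lemma enorm_integral_mul_le {f g : E3 → ℝ} (hf : AEStronglyMeasurable f volume)
    (hg : AEStronglyMeasurable g volume) :
    ‖∫ x, f x * g x‖ₑ ≤ eLpNorm f 2 volume * eLpNorm g 2 volume := by
  refine (enorm_integral_le_lintegral_enorm _).trans ?_
  rw [← eLpNorm_one_eq_lintegral_enorm]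
  have h : eLpNorm (f • g) 1 volume ≤ _ := eLpNorm_smul_le_mul_eLpNorm (p := 2) (q := 2) hg hf
  exact h

/-- Momenta of asymptotic solutions agree, along any filter of times. -/
lemma momentum_eq_of_tendsto {m : ℝ} {V : Polynomial ℝ} (hV0 : V.eval 0 = 0)
    (hV : ∀ s, 0 ≤ V.eval s) {Φ Ψ : ℝ × E3 → ℝ} (hΦ : IsGlobalSol m V Φ) (hΨ : IsFreeSol m Ψ)
    {l : Filter ℝ} [l.NeBot]
    (hl : Tendsto (fun t : ℝ =>
      eLpNorm (fun x => Φ (t, x) - Ψ (t, x)) 2 volume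
        + eLpNorm (fun x => timeDeriv Φ t x - timeDeriv Ψ t x) 2 volume) l (𝓝 (0 : ℝ≥0∞)))
    (j : Fin 3) (t s : ℝ) :
    (∫ x : E3, timeDeriv Φ t x * pderiv3 j (fun y => Φ (t, y)) x)
      = ∫ x : E3, timeDeriv Ψ s x * pderiv3 j (fun y => Ψ (s, y)) x := by
  have hu := hΦ.kgSol
  have hw : KGSol m 0 Ψ := IsGlobalSol.kgSol hΨ
  have hus := hu.smooth
  have hws := hw.smooth
  have z0 : (0 : Polynomial ℝ).eval 0 = 0 := by simp
  have zp : ∀ s : ℝ, 0 ≤ (0 : Polynomial ℝ).eval s := fun s => by simp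
  simp_rw [timeDeriv_eq hus, timeDeriv_eq hws] at hl ⊢
  simp_rw [pderiv3_eq hus, pderiv3_eq hws]
  obtain ⟨M₁, hM₁, -⟩ := hu.exists_eLpNorm_le hV0 hV
  obtain ⟨M₂, -, hM₂⟩ := (hw.space_deriv j).exists_eLpNorm_le z0 zp
  have huj := hu.slices.space hus j
  have hwj := hw.slices.space hws j
  have hwtj := (hw.space_deriv j).slices_time
  rw [← sub_eq_zero, ← enorm_eq_zero, ← nonpos_iff_eq_zero]
  have hlim := ENNReal.Tendsto.mul_const (b := ENNReal.ofReal M₁ + ENNReal.ofReal M₂) hl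
    (Or.inr (by simp))
  rw [zero_mul] at hlim
  refine ge_of_tendsto' hlim fun τ => ?_
  rw [hu.momentum_eq hV0 hV j t τ, hw.momentum_eq z0 zp j s τ]
  have parts : ∫ x, dirDeriv timeVec Ψ (τ, x) *
        (dirDeriv (spaceVec j) Φ (τ, x) - dirDeriv (spaceVec j) Ψ (τ, x))
      = -∫ x, dirDeriv timeVec (dirDeriv (spaceVec j) Ψ) (τ, x) * (Φ (τ, x) - Ψ (τ, x)) := by
    have hd : ContDiff ℝ (⊤ : ℕ∞) fun p => Φ p - Ψ p := hus.sub hws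
    have e1 : ∀ x, fderiv ℝ (fun y => Φ (τ, y) - Ψ (τ, y)) x (EuclideanSpace.single j (1 : ℝ))
        = dirDeriv (spaceVec j) Φ (τ, x) - dirDeriv (spaceVec j) Ψ (τ, x) := by
      intro x
      rw [fderiv_slice hd]
      exact dirDeriv_eq_of_hasDerivAt hd
        ((hasDerivAt_line hus _ _).sub (hasDerivAt_line hws _ _))
    have e2 : ∀ x, fderiv ℝ (fun y => dirDeriv timeVec Ψ (τ, y)) x
        (EuclideanSpace.single j (1 : ℝ)) = dirDeriv timeVec (dirDeriv (spaceVec j) Ψ) (τ, x) := by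
      intro x
      rw [fderiv_slice (dirDeriv_contDiff hws _)]
      exact dirDeriv_comm hws _ _ _
    simp_rw [← e1, ← e2]
    have hτ : Differentiable ℝ fun y : E3 => (τ, y) := by fun_prop
    refine integral_mul_fderiv_eq_neg_fderiv_mul_of_integrable ?_ ?_ ?_
      (fun x _ => ((dirDeriv_contDiff hws _).differentiable (by simp)).comp hτ x)
      (fun x _ => (hd.differentiable (by simp)).comp hτ x)
    · simp_rw [e2]
      exact (hwtj.memLp τ).integrable_mul ((hu.slices.memLp τ).sub (hw.slices.memLp τ))
    · simp_rw [e1]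
      exact (hw.slices_time.memLp τ).integrable_mul ((huj.memLp τ).sub (hwj.memLp τ))
    · exact (hw.slices_time.memLp τ).integrable_mul
        ((hu.slices.memLp τ).sub (hw.slices.memLp τ))
  have i1 : Integrable fun x => (dirDeriv timeVec Φ (τ, x) - dirDeriv timeVec Ψ (τ, x)) *
      dirDeriv (spaceVec j) Φ (τ, x) :=
    ((hu.slices_time.memLp τ).sub (hw.slices_time.memLp τ)).integrable_mul (huj.memLp τ)
  have i2 : Integrable fun x => dirDeriv timeVec Ψ (τ, x) *
      (dirDeriv (spaceVec j) Φ (τ, x) - dirDeriv (spaceVec j) Ψ (τ, x)) :=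
    (hw.slices_time.memLp τ).integrable_mul ((huj.memLp τ).sub (hwj.memLp τ))
  have split : (∫ x, dirDeriv timeVec Φ (τ, x) * dirDeriv (spaceVec j) Φ (τ, x))
      - ∫ x, dirDeriv timeVec Ψ (τ, x) * dirDeriv (spaceVec j) Ψ (τ, x)
      = (∫ x, (dirDeriv timeVec Φ (τ, x) - dirDeriv timeVec Ψ (τ, x)) *
          dirDeriv (spaceVec j) Φ (τ, x))
        - ∫ x, dirDeriv timeVec (dirDeriv (spaceVec j) Ψ) (τ, x) * (Φ (τ, x) - Ψ (τ, x)) := by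
    rw [sub_eq_add_neg _ (∫ x, dirDeriv timeVec (dirDeriv (spaceVec j) Ψ) (τ, x) *
        (Φ (τ, x) - Ψ (τ, x))), ← parts, ← integral_add i1 i2,
      ← integral_sub (hu.slices_time.integrable_mul huj τ) (hw.slices_time.integrable_mul hwj τ)]
    congr 1
    ext x
    ring
  rw [split]
  set n₀ := eLpNorm (fun x => Φ (τ, x) - Ψ (τ, x)) 2 volume
  set n₁ := eLpNorm (fun x => dirDeriv timeVec Φ (τ, x) - dirDeriv timeVec Ψ (τ, x)) 2 volume
  have b1 := enorm_integral_mul_le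
    ((hu.slices_time.memLp τ).sub (hw.slices_time.memLp τ)).aestronglyMeasurable
    (huj.memLp τ).aestronglyMeasurable
  have b2 := enorm_integral_mul_le (hwtj.memLp τ).aestronglyMeasurable
    ((hu.slices.memLp τ).sub (hw.slices.memLp τ)).aestronglyMeasurable
  refine (enorm_sub_le).trans ((add_le_add (b1.trans (mul_le_mul' le_rfl (hM₁ j τ)))
    (b2.trans (mul_le_mul' (hM₂ τ) le_rfl))).trans ?_)
  calc n₁ * ENNReal.ofReal M₁ + ENNReal.ofReal M₂ * n₀
      ≤ (n₀ + n₁) * ENNReal.ofReal M₁ + ENNReal.ofReal M₂ * (n₀ + n₁) := by gcongr <;> simp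
    _ = (n₀ + n₁) * (ENNReal.ofReal M₁ + ENNReal.ofReal M₂) := by ring

/-- the conserved linear momentum `∫ ∂ₜΦ ∂ⱼΦ dx` of a global solution
equals the free momentum of its future (resp. past) free asymptote, at all times. -/
theorem stmt_13 (m : ℝ) (hm : 0 < m) (V : Polynomial ℝ)
    (hV0 : V.eval 0 = 0) (hV1 : (derivative V).eval 0 = 0)
    (hV2 : (derivative (derivative V)).eval 0 = 0) (hVpos : ∀ s : ℝ, 0 ≤ V.eval s)
    (Φ : ℝ × E3 → ℝ) (hΦ : IsGlobalSol m V Φ) :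
    (∀ Φp : ℝ × E3 → ℝ, IsFreeSol m Φp → FutureAsym Φ Φp →
      ∀ (j : Fin 3) (t s : ℝ),
        (∫ x : E3, timeDeriv Φ t x * pderiv3 j (fun y => Φ (t, y)) x)
          = ∫ x : E3, timeDeriv Φp s x * pderiv3 j (fun y => Φp (s, y)) x) ∧
    (∀ Φm : ℝ × E3 → ℝ, IsFreeSol m Φm → PastAsym Φ Φm →
      ∀ (j : Fin 3) (t s : ℝ),
        (∫ x : E3, timeDeriv Φ t x * pderiv3 j (fun y => Φ (t, y)) x)
          = ∫ x : E3, timeDeriv Φm s x * pderiv3 j (fun y => Φm (s, y)) x) := by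
  exact ⟨fun _ hp hl j t s => momentum_eq_of_tendsto hV0 hVpos hΦ hp hl j t s,
    fun _ hp hl j t s => momentum_eq_of_tendsto hV0 hVpos hΦ hp hl j t s⟩
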